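/- arXiv:1804.04680 — 2 statements merged into one kernel-verified Lean document; each statement's English description precedes it below -/
import Mathlib

section
/- Let f : ℂ \ {0} → ℝ be a C^∞ function that is rotation invariant, i.e. f(e^{iθ}z) = f(z) for all θ ∈ ℝ and all z ∈ ℂ \ {0}. Then f extends to a C^∞ function on all of ℂ whose value at 0 is 0 if and only if there exists a C^∞ function φ : ℝ → ℝ such that f(t) = t²·φ(t²) for all real t > 0. -/
open scoped ContDiff Topology

/-- Smoothness of the averaged dilations appearing in Hadamard's lemma. -/
lemma hadamard_hasDerivAt (p : ℝ → ℝ) (hp : ContDiff ℝ ∞ p) (m : ℕ) (x₀ : ℝ) :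
    HasDerivAt (fun x => ∫ t in (0:ℝ)..1, t ^ m * p (x * t))
      (∫ t in (0:ℝ)..1, t ^ (m + 1) * deriv p (x₀ * t)) x₀ := by
  have hc : Continuous p := hp.continuous
  have hc' : Continuous (deriv p) := (contDiff_infty_iff_deriv.1 hp).2.continuous
  obtain ⟨C, hC⟩ := (isCompact_closedBall (0:ℝ) (|x₀| + 1)).exists_bound_of_continuousOn
    hc'.continuousOn
  refine (intervalIntegral.hasDerivAt_integral_of_dominated_loc_of_deriv_le
    (F := fun x t => t ^ m * p (x * t)) (F' := fun x t => t ^ (m + 1) * deriv p (x * t))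
    (bound := fun _ => C) (Metric.ball_mem_nhds x₀ one_pos) ?_ ?_ ?_ ?_ ?_ ?_).2
  · exact Filter.Eventually.of_forall fun x =>
      (by fun_prop : Continuous fun t : ℝ => t ^ m * p (x * t)).aestronglyMeasurable
  · exact (by fun_prop : Continuous fun t : ℝ => t ^ m * p (x₀ * t)).intervalIntegrable _ _
  · exact (by fun_prop :
      Continuous fun t : ℝ => t ^ (m + 1) * deriv p (x₀ * t)).aestronglyMeasurable
  · refine Filter.Eventually.of_forall fun t ht x hx => ?_
    rw [Set.uIoc_of_le zero_le_one] at ht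
    have h1 : |t| ≤ 1 := by rw [abs_of_pos ht.1]; exact ht.2
    have h2 : |x| ≤ |x₀| + 1 := by
      have h3 : |x - x₀| < 1 := by simpa [Real.dist_eq] using hx
      have h4 := abs_sub_abs_le_abs_sub x x₀
      linarith
    have h5 := hC (x * t) (by
      simp only [Metric.mem_closedBall, dist_zero_right, Real.norm_eq_abs, abs_mul]
      nlinarith [abs_nonneg x, abs_nonneg t])
    have h6 : |t| ^ (m + 1) ≤ 1 := pow_le_one₀ (abs_nonneg t) h1
    simp only [Real.norm_eq_abs, abs_mul, abs_pow] at h5 ⊢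
    nlinarith [abs_nonneg (deriv p (x * t))]
  · exact intervalIntegrable_const
  · refine Filter.Eventually.of_forall fun t ht x hx => ?_
    have h1 : HasDerivAt p (deriv p (x * t)) (x * t) :=
      ((contDiff_infty_iff_deriv.1 hp).1 _).hasDerivAt
    have h2 : HasDerivAt (fun x : ℝ => x * t) t x := by
      simpa using (hasDerivAt_id x).mul_const t
    have h3 := (h1.comp x h2).const_mul (t ^ m)
    refine h3.congr_deriv ?_
    ring

lemma hadamard_contDiff (p : ℝ → ℝ) (hp : ContDiff ℝ ∞ p) (m : ℕ) :
    ContDiff ℝ ∞ (fun x => ∫ t in (0:ℝ)..1, t ^ m * p (x * t)) := by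
  rw [contDiff_infty]
  intro n
  induction n generalizing p m with
  | zero =>
    simp only [Nat.cast_zero, contDiff_zero]
    exact continuous_iff_continuousAt.2 fun x => (hadamard_hasDerivAt p hp m x).continuousAt
  | succ n ih =>
    push_cast
    rw [contDiff_succ_iff_deriv]
    refine ⟨fun x => (hadamard_hasDerivAt p hp m x).differentiableAt, by simp, ?_⟩
    rw [show deriv (fun x => ∫ t in (0:ℝ)..1, t ^ m * p (x * t)) = _ from
      funext fun x => (hadamard_hasDerivAt p hp m x).deriv]
    exact ih _ (contDiff_infty_iff_deriv.1 hp).2 _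

/-- The Hadamard quotient. -/
noncomputable def hquot (u : ℝ → ℝ) (x : ℝ) : ℝ := ∫ t in (0:ℝ)..1, deriv u (x * t)

lemma hquot_contDiff (u : ℝ → ℝ) (hu : ContDiff ℝ ∞ u) : ContDiff ℝ ∞ (hquot u) := by
  have := hadamard_contDiff (deriv u) (contDiff_infty_iff_deriv.1 hu).2 0
  simp only [pow_zero, one_mul] at this
  exact this

lemma hquot_mul (u : ℝ → ℝ) (hu : ContDiff ℝ ∞ u) (h0 : u 0 = 0) (x : ℝ) :
    u x = x * hquot u x := by
  have h1 := intervalIntegral.mul_integral_comp_mul_left (f := deriv u) (a := 0) (b := 1) x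
  unfold hquot
  rw [h1, intervalIntegral.integral_deriv_eq_sub]
  · simp [h0]
  · intro y _; exact (contDiff_infty_iff_deriv.1 hu).1 y
  · exact (contDiff_infty_iff_deriv.1 hu).2.continuous.intervalIntegrable _ _

/-- One term of the Borel series. -/
lemma borel_term (a : ℝ) (n : ℕ) : ∃ F : ℝ → ℝ, ContDiff ℝ ∞ F ∧
    (∀ k, iteratedDeriv k F 0 = if k = n then a else 0) ∧
    (∀ k, ∃ M, ∀ x, ‖iteratedDeriv k F x‖ ≤ M) ∧
    (∀ k < n, ∀ x, ‖iteratedDeriv k F x‖ ≤ (1 / 2 : ℝ) ^ n) := by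
  let χ : ContDiffBump (0:ℝ) := default
  let u : ℝ → ℝ := fun x => x ^ n * χ x
  have hχ : ContDiff ℝ ∞ (χ : ℝ → ℝ) := χ.contDiff
  have hu : ContDiff ℝ ∞ u := by fun_prop
  have hsupp : HasCompactSupport u := χ.hasCompactSupport.mul_left
  have hM : ∀ k, ∃ M, ∀ x, ‖iteratedDeriv k u x‖ ≤ M := by
    intro k
    have h1 : HasCompactSupport (iteratedFDeriv ℝ k u) := hsupp.iteratedFDeriv k
    have h2 : Continuous (iteratedFDeriv ℝ k u) :=
      hu.continuous_iteratedFDeriv (by exact_mod_cast le_top)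
    obtain ⟨M, hM⟩ := h1.exists_bound_of_continuous h2
    exact ⟨M, fun x => by rw [← norm_iteratedFDeriv_eq_norm_iteratedDeriv]; exact hM x⟩
  choose M hM using hM
  have hM0 : ∀ k, 0 ≤ M k := fun k => (norm_nonneg _).trans (hM k 0)
  have hu0 : ∀ k, iteratedDeriv k u 0 = if k = n then (n.factorial : ℝ) else 0 := by
    intro k
    have hp := iteratedDeriv_fun_pow_zero (𝕜 := ℝ) (n := k) (m := n)
    push_cast at hp
    rw [← hp]
    apply Filter.EventuallyEq.iteratedDeriv_eq
    filter_upwards [χ.eventuallyEq_one] with x hx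
    simp [u, hx]
  set b : ℝ := a / n.factorial with hb
  set S : ℝ := ∑ k ∈ Finset.range n, M k with hS
  have hS0 : 0 ≤ S := Finset.sum_nonneg fun k _ => hM0 k
  set l : ℝ := 1 + |b| * S * 2 ^ n with hl
  have hl1 : 1 ≤ l := by
    have : 0 ≤ |b| * S * 2 ^ n := by positivity
    linarith
  have hl0 : 0 < l := by linarith
  have hD : ∀ k x, iteratedDeriv k (fun x => (b * (l ^ n)⁻¹) * u (l * x)) x
      = (b * (l ^ n)⁻¹) * (l ^ k * iteratedDeriv k u (l * x)) := by
    intro k x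
    rw [iteratedDeriv_const_mul_field (b * (l ^ n)⁻¹) (fun x => u (l * x)),
      iteratedDeriv_comp_const_mul (hu.of_le (by exact_mod_cast le_top)) l]
  refine ⟨fun x => (b * (l ^ n)⁻¹) * u (l * x), by fun_prop, ?_, ?_, ?_⟩
  · intro k
    rw [hD, mul_zero, hu0]
    split_ifs with h
    · subst h
      have := Nat.factorial_ne_zero k
      rw [hb]; field_simp
    · simp
  · intro k
    refine ⟨|b * (l ^ n)⁻¹| * (l ^ k * M k), fun x => ?_⟩
    rw [hD, norm_mul, norm_mul (l ^ k), Real.norm_eq_abs, Real.norm_of_nonneg (by positivity : 0 ≤ l ^ k)]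
    gcongr
    exact hM k _
  · intro k hk x
    rw [hD, norm_mul, norm_mul, norm_mul, Real.norm_of_nonneg (by positivity : 0 ≤ l ^ k),
      Real.norm_of_nonneg (by positivity : 0 ≤ (l ^ n)⁻¹), Real.norm_eq_abs b]
    have h1 : ‖iteratedDeriv k u (l * x)‖ ≤ S := (hM k _).trans
      (Finset.single_le_sum (fun k _ => hM0 k) (Finset.mem_range.2 hk))
    have h2 : l ^ k * l ≤ l ^ n := by
      rw [← pow_succ]; exact pow_le_pow_right₀ hl1 hk
    have h3 : |b| * S * 2 ^ n ≤ l := by linarith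
    rw [one_div, inv_pow]
    have h2n : (0:ℝ) < 2 ^ n := by positivity
    have hln : (0:ℝ) < l ^ n := by positivity
    calc |b| * (l ^ n)⁻¹ * (l ^ k * ‖iteratedDeriv k u (l * x)‖)
        ≤ |b| * (l ^ n)⁻¹ * (l ^ k * S) := by gcongr
      _ = (l ^ k * (|b| * S * 2 ^ n)) * ((l ^ n)⁻¹ * (2 ^ n)⁻¹) := by field_simp
      _ ≤ (l ^ k * l) * ((l ^ n)⁻¹ * (2 ^ n)⁻¹) := by gcongr
      _ ≤ l ^ n * ((l ^ n)⁻¹ * (2 ^ n)⁻¹) := by gcongr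
      _ = (2 ^ n)⁻¹ := by field_simp

/-- Borel's lemma. -/
lemma borel_realize (a : ℕ → ℝ) : ∃ B : ℝ → ℝ, ContDiff ℝ ∞ B ∧ ∀ k, iteratedDeriv k B 0 = a k := by
  choose F hF hF0 hFM hFb using fun n => borel_term (a n) n
  choose M hM using hFM
  let v : ℕ → ℕ → ℝ := fun k n => if k < n then (1 / 2 : ℝ) ^ n else M n k
  have hv : ∀ k, Summable (v k) := by
    intro k
    refine (summable_congr_cofinite ?_).1 summable_geometric_two
    rw [Nat.cofinite_eq_atTop]
    filter_upwards [Filter.eventually_gt_atTop k] with n hn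
    simp [v, hn]
  have hb : ∀ k n x, ‖iteratedFDeriv ℝ k (F n) x‖ ≤ v k n := by
    intro k n x
    rw [norm_iteratedFDeriv_eq_norm_iteratedDeriv]
    by_cases h : k < n
    · simpa [v, h] using hFb n k h x
    · simpa [v, h] using hM n k x
  refine ⟨fun x => ∑' n, F n x, ?_, ?_⟩
  · exact contDiff_tsum (N := ⊤) hF (fun k _ => hv k) (fun k n x _ => hb k n x)
  · intro k
    rw [iteratedDeriv_eq_iteratedFDeriv, iteratedFDeriv_tsum_apply (N := ⊤) hF (fun k _ => hv k)
      (fun k n x _ => hb k n x) le_top]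
    have hs : Summable fun n => iteratedFDeriv ℝ k (F n) 0 :=
      .of_norm_bounded (hv k) fun n => hb k n 0
    rw [ContinuousMultilinearMap.tsum_eval hs]
    simp_rw [← iteratedDeriv_eq_iteratedFDeriv, hF0]
    simp

/-- Half the Hadamard quotient of the derivative. -/
noncomputable def Lop (u : ℝ → ℝ) (x : ℝ) : ℝ := hquot (deriv u) x / 2

lemma Lop_contDiff (u : ℝ → ℝ) (hu : ContDiff ℝ ∞ u) : ContDiff ℝ ∞ (Lop u) :=
  (hquot_contDiff _ (contDiff_infty_iff_deriv.1 hu).2).div_const 2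

lemma deriv_odd_of_even (u : ℝ → ℝ) (he : ∀ x, u (-x) = u x) (x : ℝ) :
    deriv u (-x) = - deriv u x := by
  have h := deriv_comp_neg u x
  rw [show (fun x => u (-x)) = u from funext he] at h
  linarith

lemma deriv_even_of_odd (u : ℝ → ℝ) (he : ∀ x, u (-x) = - u x) (x : ℝ) :
    deriv u (-x) = deriv u x := by
  have h := deriv_comp_neg u x
  rw [show (fun x => u (-x)) = fun x => - u x from funext he, deriv.fun_neg] at h
  linarith

lemma Lop_even (u : ℝ → ℝ) (he : ∀ x, u (-x) = u x) (x : ℝ) : Lop u (-x) = Lop u x := by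
  simp only [Lop, hquot, neg_mul, deriv_even_of_odd _ (deriv_odd_of_even u he)]

lemma Lop_mul (u : ℝ → ℝ) (hu : ContDiff ℝ ∞ u) (he : ∀ x, u (-x) = u x) (x : ℝ) :
    deriv u x = 2 * x * Lop u x := by
  have h0 : deriv u 0 = 0 := by
    have := deriv_odd_of_even u he 0
    rw [neg_zero] at this; linarith
  have := hquot_mul (deriv u) (contDiff_infty_iff_deriv.1 hu).2 h0 x
  rw [this, Lop]; ring

/-- Gluing of `u ∘ √` on the right with `B` on the left. -/
noncomputable def glue (u B : ℝ → ℝ) (s : ℝ) : ℝ := if 0 ≤ s then u (√s) else B s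

lemma glue_continuous (u B : ℝ → ℝ) (hu : Continuous u) (hB : Continuous B) (h : B 0 = u 0) :
    Continuous (glue u B) := by
  refine Continuous.if_le (by fun_prop) hB continuous_const continuous_id ?_
  rintro x rfl
  simp [h]

lemma glue_hasDerivAt (u B : ℝ → ℝ) (hu : ContDiff ℝ ∞ u) (he : ∀ x, u (-x) = u x)
    (hB : ContDiff ℝ ∞ B) (h : B 0 = u 0) (h' : deriv B 0 = Lop u 0) (s : ℝ) :
    HasDerivAt (glue u B) (glue (Lop u) (deriv B) s) s := by
  refine hasDerivAt_of_hasDerivAt_of_ne' (x := 0) ?_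
    (glue_continuous u B hu.continuous hB.continuous h).continuousAt
    (glue_continuous _ _ (Lop_contDiff u hu).continuous
      (contDiff_infty_iff_deriv.1 hB).2.continuous h').continuousAt s
  intro y hy
  rcases lt_or_gt_of_ne hy with hy | hy
  · have h1 : HasDerivAt B (deriv B y) y := ((contDiff_infty_iff_deriv.1 hB).1 y).hasDerivAt
    have h2 : glue u B =ᶠ[𝓝 y] B := by
      filter_upwards [Iio_mem_nhds hy] with z hz
      simp only [glue, if_neg (not_le.2 (Set.mem_Iio.1 hz))]
    rw [glue, if_neg (not_le.2 hy)]
    exact h1.congr_of_eventuallyEq h2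
  · have h1 : HasDerivAt u (deriv u (√y)) (√y) :=
      ((contDiff_infty_iff_deriv.1 hu).1 _).hasDerivAt
    have h2 : glue u B =ᶠ[𝓝 y] fun z => u (√z) := by
      filter_upwards [Ioi_mem_nhds hy] with z hz
      simp only [glue, if_pos (le_of_lt (Set.mem_Ioi.1 hz))]
    rw [glue, if_pos hy.le]
    have h3 := (h1.comp y (Real.hasDerivAt_sqrt hy.ne')).congr_of_eventuallyEq h2
    refine h3.congr_deriv ?_
    have : √y ≠ 0 := (Real.sqrt_pos.2 hy).ne'
    rw [Lop_mul u hu he]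
    field_simp

lemma glue_contDiff (u B : ℝ → ℝ) (hu : ContDiff ℝ ∞ u) (he : ∀ x, u (-x) = u x)
    (hB : ContDiff ℝ ∞ B) (h : ∀ k, iteratedDeriv k B 0 = Lop^[k] u 0) :
    ContDiff ℝ ∞ (glue u B) := by
  rw [contDiff_infty]
  intro n
  induction n generalizing u B with
  | zero =>
    simp only [Nat.cast_zero, contDiff_zero]
    exact glue_continuous u B hu.continuous hB.continuous (by simpa using h 0)
  | succ n ih =>
    have hd := glue_hasDerivAt u B hu he hB (by simpa using h 0) (by simpa using h 1)
    push_cast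
    rw [contDiff_succ_iff_deriv]
    refine ⟨fun x => (hd x).differentiableAt, by simp, ?_⟩
    rw [show deriv (glue u B) = _ from funext fun x => (hd x).deriv]
    refine ih _ _ (Lop_contDiff u hu) (Lop_even u he) (contDiff_infty_iff_deriv.1 hB).2 ?_
    intro k
    rw [← iteratedDeriv_succ', h (k + 1), Function.iterate_succ_apply]

/-- Whitney's theorem on even functions. -/
lemma whitney_even (u : ℝ → ℝ) (hu : ContDiff ℝ ∞ u) (he : ∀ x, u (-x) = u x) :
    ∃ Φ : ℝ → ℝ, ContDiff ℝ ∞ Φ ∧ ∀ t, 0 ≤ t → u t = Φ (t ^ 2) := by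
  obtain ⟨B, hB, hB0⟩ := borel_realize fun k => Lop^[k] u 0
  refine ⟨glue u B, glue_contDiff u B hu he hB hB0, fun t ht => ?_⟩
  rw [glue, if_pos (sq_nonneg t), Real.sqrt_sq ht]

theorem rotation_invariant_vanishing_extension_iff
    (f : ℂ → ℝ) (hf : ContDiffOn ℝ (⊤ : ℕ∞) f {0}ᶜ)
    (hinv : ∀ (θ : ℝ) (z : ℂ), z ≠ 0 →
      f (Complex.exp (θ * Complex.I) * z) = f z) :
    (∃ g : ℂ → ℝ, ContDiff ℝ (⊤ : ℕ∞) g ∧ g 0 = 0 ∧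
        ∀ z : ℂ, z ≠ 0 → g z = f z) ↔
      ∃ φ : ℝ → ℝ, ContDiff ℝ (⊤ : ℕ∞) φ ∧
        ∀ t : ℝ, 0 < t → f (t : ℂ) = t ^ 2 * φ (t ^ 2) := by
  constructor
  · rintro ⟨g, hg, hg0, hgf⟩
    have hu : ContDiff ℝ ∞ (fun t : ℝ => g (t : ℂ)) := hg.comp Complex.ofRealCLM.contDiff
    obtain ⟨Φ, hΦ, hΦu⟩ := whitney_even _ hu (by
      intro x
      by_cases hx : x = 0
      · simp [hx]
      have hx' : (x : ℂ) ≠ 0 := by exact_mod_cast hx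
      have h := hinv Real.pi x hx'
      rw [Complex.exp_pi_mul_I, neg_one_mul] at h
      simp only [Complex.ofReal_neg]
      rw [hgf _ (neg_ne_zero.2 hx'), hgf _ hx', h])
    have hΦ0 : Φ 0 = 0 := by
      have := hΦu 0 le_rfl
      simpa [hg0] using this.symm
    refine ⟨hquot Φ, hquot_contDiff Φ hΦ, fun t ht => ?_⟩
    rw [← hquot_mul Φ hΦ hΦ0, ← hΦu t ht.le, hgf]
    exact_mod_cast ht.ne'
  · rintro ⟨φ, hφ, hφf⟩
    have hn : ContDiff ℝ ∞ (fun z : ℂ => ‖z‖ ^ 2) := contDiff_norm_sq ℝ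
    refine ⟨fun z => ‖z‖ ^ 2 * φ (‖z‖ ^ 2), hn.mul (hφ.comp hn), by simp, fun z hz => ?_⟩
    have hz' : 0 < ‖z‖ := norm_pos_iff.2 hz
    have h := hinv z.arg (‖z‖ : ℂ) (by exact_mod_cast hz'.ne')
    rw [mul_comm, Complex.norm_mul_exp_arg_mul_I] at h
    rw [h, hφf _ hz']
end

section
/- Let a and d be positive integers with a dividing 2d, and set q = 2d/a. Let H : ℂ \ {0} → M₂(ℝ) be a C^∞ function satisfying H(e^{iaθ}z) = R(dθ)·H(z)·R(dθ)ᵀ for all θ ∈ ℝ and z ∈ ℂ \ {0}. Then H extends to a C^∞ function on all of ℂ with H(0) = 0 if and only if there exist C^∞ functions φ₁, φ₂, φ₃, φ₄ : ℝ → ℝ such that for all real t > 0: H(t)₁₁ = t²·φ₁(t²) + t^q·φ₃(t²), H(t)₂₂ = t²·φ₁(t²) − t^q·φ₃(t²), H(t)₁₂ = t²·φ₂(t²) + t^q·φ₄(t²), and H(t)₂₁ = −t²·φ₂(t²) + t^q·φ₄(t²). -/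
open Matrix

/-- The 2×2 rotation matrix `R(θ)`. -/
noncomputable def rotMat (θ : ℝ) : Matrix (Fin 2) (Fin 2) ℝ :=
  !![Real.cos θ, -Real.sin θ; Real.sin θ, Real.cos θ]

open scoped ContDiff Topology
open Filter Asymptotics

section Hadamard
variable {E : Type*} [NormedAddCommGroup E] [NormedSpace ℝ E] [CompleteSpace E]

theorem hasDerivAt_avg (q : ℕ) (k : ℝ → E) (hk : ContDiff ℝ ∞ k) (t₀ : ℝ) :
    HasDerivAt (fun t : ℝ => ∫ u in (0 : ℝ)..1, u ^ q • k (t * u))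
      (∫ u in (0 : ℝ)..1, u ^ (q + 1) • deriv k (t₀ * u)) t₀ := by
  have hk' : Continuous (deriv k) := hk.continuous_deriv (by simp)
  have hkc : Continuous k := hk.continuous
  obtain ⟨C, hC⟩ := (isCompact_Icc (a := -(|t₀| + 1)) (b := |t₀| + 1)).exists_bound_of_continuousOn
    hk'.continuousOn
  refine (intervalIntegral.hasDerivAt_integral_of_dominated_loc_of_deriv_le
    (F := fun t u => u ^ q • k (t * u)) (F' := fun t u => u ^ (q + 1) • deriv k (t * u))
    (bound := fun _ => C) (s := Metric.ball t₀ 1) (Metric.ball_mem_nhds _ one_pos)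
    (Eventually.of_forall fun t => ?_) ?_ ?_ ?_ ?_ ?_).2
  · exact (by fun_prop : Continuous fun u : ℝ => u ^ q • k (t * u)).aestronglyMeasurable
  · exact (by fun_prop : Continuous fun u : ℝ => u ^ q • k (t₀ * u)).intervalIntegrable _ _
  · exact (by fun_prop :
      Continuous fun u : ℝ => u ^ (q + 1) • deriv k (t₀ * u)).aestronglyMeasurable
  · refine Eventually.of_forall fun u hu t ht => ?_
    rw [Set.uIoc_of_le zero_le_one] at hu
    have h1 : |t| ≤ |t₀| + 1 := by
      have := abs_sub_abs_le_abs_sub t t₀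
      rw [Metric.mem_ball, Real.dist_eq] at ht
      linarith
    have h2 : |t * u| ≤ |t₀| + 1 := by
      rw [abs_mul, abs_of_pos hu.1]
      nlinarith [abs_nonneg t, hu.2, hu.1]
    have h3 := hC (t * u) (abs_le.1 h2)
    rw [norm_smul]
    have h4 : ‖u ^ (q + 1)‖ ≤ 1 := by
      rw [norm_pow, Real.norm_of_nonneg hu.1.le]
      exact pow_le_one₀ hu.1.le hu.2
    calc _ ≤ 1 * ‖deriv k (t * u)‖ := by gcongr
      _ ≤ C := by rw [one_mul]; exact h3
  · exact intervalIntegrable_const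
  · refine Eventually.of_forall fun u hu t ht => ?_
    have h1 : HasDerivAt k (deriv k (t * u)) (t * u) :=
      (hk.differentiable (by simp)).differentiableAt.hasDerivAt
    have h2 : HasDerivAt (fun t : ℝ => t * u) u t := by
      simpa using (hasDerivAt_id t).mul_const u
    have h3 := (h1.scomp t h2).const_smul (u ^ q)
    rw [smul_smul, ← pow_succ] at h3
    exact h3

theorem contDiff_avg (n : ℕ) : ∀ (q : ℕ) (k : ℝ → E), ContDiff ℝ ∞ k →
    ContDiff ℝ n (fun t : ℝ => ∫ u in (0 : ℝ)..1, u ^ q • k (t * u)) := by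
  induction n with
  | zero =>
    intro q k hk
    refine contDiff_zero.2 (continuous_iff_continuousAt.2 fun t => ?_)
    exact (hasDerivAt_avg q k hk t).continuousAt
  | succ n ih =>
    intro q k hk
    push_cast
    rw [contDiff_succ_iff_deriv]
    refine ⟨fun t => (hasDerivAt_avg q k hk t).differentiableAt, by simp, ?_⟩
    have : deriv (fun t : ℝ => ∫ u in (0 : ℝ)..1, u ^ q • k (t * u)) =
        fun t : ℝ => ∫ u in (0 : ℝ)..1, u ^ (q + 1) • deriv k (t * u) :=
      funext fun t => (hasDerivAt_avg q k hk t).deriv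
    rw [this]
    exact ih (q + 1) (deriv k) (contDiff_infty_iff_deriv.1 hk).2

theorem hadamard_pow (q : ℕ) : ∀ f : ℝ → E, ContDiff ℝ ∞ f →
    (∀ k < q, iteratedDeriv k f 0 = 0) →
    ∃ h : ℝ → E, ContDiff ℝ ∞ h ∧ ∀ t, f t = t ^ q • h t := by
  induction q with
  | zero => intro f hf _; exact ⟨f, hf, by simp⟩
  | succ q ih =>
    intro f hf h0
    have hf' := (contDiff_infty_iff_deriv.1 hf).2
    obtain ⟨k, hk, hfk⟩ := ih (deriv f) hf' (fun j hj => by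
      rw [← iteratedDeriv_succ']; exact h0 (j + 1) (by omega))
    refine ⟨fun t => ∫ u in (0 : ℝ)..1, u ^ q • k (t * u),
      contDiff_infty.2 fun n => contDiff_avg n q k hk, fun t => ?_⟩
    have h00 : f 0 = 0 := by simpa using h0 0 (by omega)
    have h1 : ∫ x in (0 : ℝ)..t, deriv f x = f t - f 0 :=
      intervalIntegral.integral_deriv_eq_sub
        (fun x _ => (hf.differentiable (by simp)).differentiableAt)
        ((hf.continuous_deriv (by simp)).intervalIntegrable _ _)
    have h2 := intervalIntegral.smul_integral_comp_mul_left (a := 0) (b := 1) (deriv f) t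
    simp only [mul_zero, mul_one] at h2
    rw [h1, h00, sub_zero] at h2
    have h3 : ∫ u in (0 : ℝ)..1, deriv f (t * u) =
        t ^ q • ∫ u in (0 : ℝ)..1, u ^ q • k (t * u) := by
      rw [← intervalIntegral.integral_smul]
      exact intervalIntegral.integral_congr fun u _ => by simp only [hfk, mul_pow, mul_smul]
    rw [← h2, h3, pow_succ', mul_smul]

theorem hadamard_one (f : ℝ → E) (hf : ContDiff ℝ ∞ f) (h0 : f 0 = 0) :
    ∃ h : ℝ → E, ContDiff ℝ ∞ h ∧ ∀ t, f t = t • h t := by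
  simpa using hadamard_pow 1 f hf (fun k hk => by
    obtain rfl : k = 0 := by omega
    simpa using h0)

end Hadamard

/-- Infinite order of vanishing at the origin. -/
def FlatAtZero (f : ℝ → ℝ) : Prop :=
  ∀ N : ℕ, ∃ h : ℝ → ℝ, ContDiff ℝ ∞ h ∧ ∀ t, f t = t ^ N * h t

theorem eq_of_punctured (f g : ℝ → ℝ) (hf : Continuous f) (hg : Continuous g)
    (h : ∀ t, t ≠ 0 → f t = g t) : f = g := by
  refine Continuous.ext_on (dense_compl_singleton (0 : ℝ)) hf hg ?_
  intro t ht
  exact h t ht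

theorem flat_deriv (f : ℝ → ℝ) (h : FlatAtZero f) :
    ∃ k : ℝ → ℝ, ContDiff ℝ ∞ k ∧ FlatAtZero k ∧ ∀ t, deriv f t = t * k t := by
  have key : ∀ N : ℕ, ∃ m : ℝ → ℝ, ContDiff ℝ ∞ m ∧ ∀ t, deriv f t = t * (t ^ N * m t) := by
    intro N
    obtain ⟨h, hh, hf⟩ := h (N + 2)
    refine ⟨fun t => (N + 2) * h t + t * deriv h t, ?_, fun t => ?_⟩
    · have := (contDiff_infty_iff_deriv.1 hh).2
      fun_prop
    · have e : f = fun t => t ^ (N + 2) * h t := funext hf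
      have h1 : HasDerivAt h (deriv h t) t :=
        (hh.differentiable (by simp)).differentiableAt.hasDerivAt
      have h2 := (hasDerivAt_pow (N + 2) t).mul h1
      rw [e]
      refine h2.deriv.trans ?_
      rw [show N + 2 - 1 = N + 1 from rfl]
      push_cast
      ring
  obtain ⟨k, hk, hfk⟩ := key 0
  refine ⟨k, hk, fun N => ?_, fun t => by simpa using hfk t⟩
  obtain ⟨m, hm, hfm⟩ := key N
  refine ⟨m, hm, fun t => ?_⟩
  refine congrFun (eq_of_punctured k (fun t => t ^ N * m t) hk.continuous
    (by have := hm.continuous; fun_prop) fun t ht => ?_) t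
  have := (hfk t).symm.trans (hfm t)
  simpa using mul_left_cancel₀ ht this

theorem hasDerivAt_flat_sqrt (f k : ℝ → ℝ) (hf : ContDiff ℝ ∞ f) (h : FlatAtZero f)
    (hk : ∀ t, deriv f t = t * k t) (s : ℝ) :
    HasDerivAt (fun s => if 0 < s then f (√s) else 0) ((if 0 < s then k (√s) else 0) / 2) s := by
  rcases lt_trichotomy s 0 with hs | hs | hs
  · rw [if_neg (by linarith), zero_div]
    refine (hasDerivAt_const s (0 : ℝ)).congr_of_eventuallyEq ?_
    filter_upwards [gt_mem_nhds hs] with x hx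
    rw [if_neg (by linarith)]
  · subst hs
    obtain ⟨m, hm, hfm⟩ := h 4
    simp only [lt_irrefl, if_false, zero_div]
    rw [hasDerivAt_iff_isLittleO]
    simp only [lt_irrefl, if_false, sub_zero, smul_zero]
    have h1 : (fun s : ℝ => if 0 < s then f (√s) else 0) =O[𝓝 0] fun s => s * (s * m (√s)) := by
      refine IsBigO.of_bound 1 (Eventually.of_forall fun s => ?_)
      split_ifs with hs
      · rw [hfm, one_mul]
        have : √s ^ 4 = s * s := by
          rw [show √s ^ 4 = (√s ^ 2) ^ 2 by ring, Real.sq_sqrt hs.le]; ring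
        rw [this, mul_assoc]
      · simp only [norm_zero]; positivity
    refine h1.trans_isLittleO ?_
    have h2 : (fun s : ℝ => s * m (√s)) =o[𝓝 0] fun _ => (1 : ℝ) := by
      rw [isLittleO_one_iff]
      have hc : Continuous fun s : ℝ => s * m (√s) := by
        have := hm.continuous
        fun_prop
      simpa using hc.tendsto 0
    simpa using (isBigO_refl (fun s : ℝ => s) (𝓝 0)).mul_isLittleO h2
  · rw [if_pos hs]
    have h1 : HasDerivAt f (deriv f (√s)) (√s) :=
      (hf.differentiable (by simp)).differentiableAt.hasDerivAt
    have h2 := h1.comp s (Real.hasDerivAt_sqrt hs.ne')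
    rw [hk] at h2
    have h3 : √s ≠ 0 := (Real.sqrt_pos.2 hs).ne'
    have h4 : √s * k √s * (1 / (2 * √s)) = k √s / 2 := by field_simp
    rw [h4] at h2
    refine h2.congr_of_eventuallyEq ?_
    filter_upwards [lt_mem_nhds hs] with x hx
    simp [hx]

theorem contDiff_flat_sqrt (n : ℕ) : ∀ f : ℝ → ℝ, ContDiff ℝ ∞ f → FlatAtZero f →
    ContDiff ℝ n (fun s => if 0 < s then f (√s) else 0) := by
  induction n with
  | zero =>
    intro f hf h
    obtain ⟨k, hk, hkf, hfk⟩ := flat_deriv f h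
    refine contDiff_zero.2 (continuous_iff_continuousAt.2 fun t => ?_)
    exact (hasDerivAt_flat_sqrt f k hf h hfk t).continuousAt
  | succ n ih =>
    intro f hf h
    obtain ⟨k, hk, hkf, hfk⟩ := flat_deriv f h
    push_cast
    rw [contDiff_succ_iff_deriv]
    refine ⟨fun t => (hasDerivAt_flat_sqrt f k hf h hfk t).differentiableAt, by simp, ?_⟩
    have : deriv (fun s => if 0 < s then f (√s) else 0) =
        fun s => (if 0 < s then k (√s) else 0) / 2 :=
      funext fun t => (hasDerivAt_flat_sqrt f k hf h hfk t).deriv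
    rw [this]
    exact (ih k hk hkf).div_const 2

theorem flat_of_isBigO (f : ℝ → ℝ) (hf : ContDiff ℝ ∞ f)
    (h : ∀ N : ℕ, f =O[𝓝 0] fun t => t ^ N) : FlatAtZero f := by
  intro N
  induction N with
  | zero => exact ⟨f, hf, by simp⟩
  | succ N ih =>
    obtain ⟨k, hk, hfk⟩ := ih
    have h0 : k 0 = 0 := by
      have h1 : k =O[𝓝[≠] 0] fun t => t := by
        obtain ⟨C, hC⟩ := (h (N + 1)).bound
        refine IsBigO.of_bound C ?_
        filter_upwards [nhdsWithin_le_nhds hC, self_mem_nhdsWithin] with t ht ht0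
        rw [hfk, pow_succ, norm_mul, norm_mul, mul_left_comm] at ht
        exact le_of_mul_le_mul_left ht (norm_pos_iff.2 (pow_ne_zero _ ht0))
      have h2 : Tendsto k (𝓝[≠] 0) (𝓝 0) :=
        h1.trans_tendsto (tendsto_id.mono_left nhdsWithin_le_nhds)
      have h3 : Tendsto k (𝓝[≠] 0) (𝓝 (k 0)) :=
        (hk.continuous.tendsto 0).mono_left nhdsWithin_le_nhds
      exact tendsto_nhds_unique h3 h2
    obtain ⟨m, hm, hkm⟩ := hadamard_one k hk h0
    exact ⟨m, hm, fun t => by rw [hfk, hkm, smul_eq_mul, pow_succ]; ring⟩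

theorem borel_lemma (a : ℕ → ℝ) : ∃ b : ℝ → ℝ, ContDiff ℝ ∞ b ∧
    ∀ N : ℕ, (fun s => b s - ∑ n ∈ Finset.range (N + 1), a n * s ^ n) =O[𝓝 0] fun s => s ^ N := by
  let χ : ContDiffBump (0 : ℝ) := ⟨1, 2, one_pos, one_lt_two⟩
  have hχ : ContDiff ℝ ∞ χ := χ.contDiff
  let u : ℕ → ℝ → ℝ := fun n s => s ^ n * χ s
  have hu : ∀ n, ContDiff ℝ ∞ (u n) := fun n => by
    show ContDiff ℝ ∞ fun s => s ^ n * χ s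
    fun_prop
  have hM : ∀ n, ∃ M : ℝ, 0 ≤ M ∧ ∀ k < n, ∀ s, ‖iteratedDeriv k (u n) s‖ ≤ M := by
    intro n
    have h1 : ∀ k, ∃ M : ℝ, ∀ s, ‖iteratedDeriv k (u n) s‖ ≤ M := by
      intro k
      have hc : HasCompactSupport (u n) := χ.hasCompactSupport.mul_left
      obtain ⟨M, hM⟩ := (hc.iteratedFDeriv (𝕜 := ℝ) k).exists_bound_of_continuous
        ((hu n).continuous_iteratedFDeriv (m := k) (by exact_mod_cast le_top))
      exact ⟨M, fun s => by rw [← norm_iteratedFDeriv_eq_norm_iteratedDeriv]; exact hM s⟩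
    choose M hM using h1
    refine ⟨∑ k ∈ Finset.range n, |M k|, by positivity, fun k hk s => ?_⟩
    refine (hM k s).trans ((le_abs_self _).trans ?_)
    exact Finset.single_le_sum (f := fun k => |M k|) (fun i _ => abs_nonneg _)
      (Finset.mem_range.2 hk)
  choose M hM0 hM using hM
  let l : ℕ → ℝ := fun n => 1 + |a n| * (M n + 1) * 4 ^ n
  have hl1 : ∀ n, 1 ≤ l n := fun n => by
    have := hM0 n
    have : 0 ≤ |a n| * (M n + 1) * 4 ^ n := by positivity
    simp only [l]; linarith
  have hl0 : ∀ n, 0 < l n := fun n => lt_of_lt_of_le one_pos (hl1 n)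
  have hlM : ∀ n, |a n| * M n / l n ≤ (1 / 2) ^ n := fun n => by
    rw [div_le_iff₀ (hl0 n), div_pow, one_pow, one_div, inv_mul_eq_div,
      le_div_iff₀ (by positivity)]
    have h4 : (2 : ℝ) ^ n ≤ 4 ^ n := by gcongr; norm_num
    have h5 := hM0 n
    calc |a n| * M n * 2 ^ n ≤ |a n| * (M n + 1) * 4 ^ n := by gcongr; linarith
      _ ≤ l n := by simp only [l]; linarith
  have hl2 : ∀ n, |a n| * 2 ^ n / l n ≤ (1 / 2) ^ n := fun n => by
    rw [div_le_iff₀ (hl0 n), div_pow, one_pow, one_div, inv_mul_eq_div,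
      le_div_iff₀ (by positivity)]
    have h5 := hM0 n
    calc |a n| * 2 ^ n * 2 ^ n = |a n| * 1 * 4 ^ n := by
          rw [mul_assoc, ← mul_pow]; norm_num
      _ ≤ |a n| * (M n + 1) * 4 ^ n := by gcongr; linarith
      _ ≤ l n := by simp only [l]; linarith
  let v : ℕ → ℝ → ℝ := fun n s => a n * s ^ n * χ (l n * s)
  have hvu : ∀ n, v n = fun s => (a n / l n ^ n) * u n (l n * s) := fun n => by
    ext s
    have := (hl0 n).ne'
    simp only [v, u, mul_pow]
    field_simp
  have hv : ∀ n, ContDiff ℝ ∞ (v n) := fun n => by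
    show ContDiff ℝ ∞ fun s => a n * s ^ n * χ (l n * s)
    fun_prop
  have hgeom : Summable fun n : ℕ => ((1 : ℝ) / 2) ^ n :=
    summable_geometric_of_lt_one (by norm_num) (by norm_num)
  have hvk : ∀ k n, k < n → ∀ s, ‖iteratedFDeriv ℝ k (v n) s‖ ≤ (1 / 2) ^ n := by
    intro k n hkn s
    rw [norm_iteratedFDeriv_eq_norm_iteratedDeriv, hvu]
    have e1 : iteratedDeriv k (fun s => a n / l n ^ n * u n (l n * s)) s =
        a n / l n ^ n * (l n ^ k * iteratedDeriv k (u n) (l n * s)) := by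
      rw [iteratedDeriv_const_mul_field]
      congr 1
      have := iteratedDeriv_comp_const_mul (𝕜 := ℝ) (n := k) (f := u n)
        ((hu n).of_le (by exact_mod_cast le_top)) (l n)
      simpa using congrFun this s
    rw [e1]
    refine le_trans ?_ (hlM n)
    rw [norm_mul, norm_mul, norm_div, norm_pow, norm_pow, Real.norm_of_nonneg (hl0 n).le,
      Real.norm_eq_abs (a n)]
    have h1 := hM n k hkn (l n * s)
    obtain ⟨j, rfl⟩ := Nat.exists_eq_add_of_lt hkn
    set L := l (k + j + 1)
    have hL1 : 1 ≤ L := hl1 _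
    have hL : 0 < L := hl0 _
    have e2 : |a (k + j + 1)| / L ^ (k + j + 1) *
        (L ^ k * ‖iteratedDeriv k (u (k + j + 1)) (L * s)‖) =
        (|a (k + j + 1)| * ‖iteratedDeriv k (u (k + j + 1)) (L * s)‖ / L) / L ^ j := by
      rw [pow_succ, pow_add]; field_simp
    rw [e2]
    refine (div_le_self (by positivity) (one_le_pow₀ hL1)).trans ?_
    gcongr
  have hvN : ∀ N n, N < n → ∀ s, ‖v n s‖ ≤ |s| ^ N * (1 / 2) ^ n := by
    intro N n hn s
    by_cases hs : 2 ≤ |l n * s|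
    · have : χ (l n * s) = 0 := χ.zero_of_le_dist (by simpa [Real.dist_eq] using hs)
      simp only [v, this, mul_zero, norm_zero]; positivity
    · push Not at hs
      rw [abs_mul, abs_of_pos (hl0 n)] at hs
      have hχ1 : ‖χ (l n * s)‖ ≤ 1 := by
        rw [Real.norm_of_nonneg χ.nonneg]; exact χ.le_one
      have hs2 : |s| ≤ 2 / l n := by
        rw [le_div_iff₀ (hl0 n)]; linarith
      have hlast : |s| ^ (n - N) ≤ 2 ^ n / l n := by
        obtain ⟨j, rfl⟩ := Nat.exists_eq_add_of_lt hn
        rw [show N + j + 1 - N = j + 1 by omega]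
        calc |s| ^ (j + 1) ≤ (2 / l (N + j + 1)) ^ (j + 1) := by gcongr
          _ = 2 ^ (j + 1) / l (N + j + 1) / l (N + j + 1) ^ j := by
            have := (hl0 (N + j + 1)).ne'
            rw [div_pow, pow_succ (l (N + j + 1)), div_div]; congr 1; ring
          _ ≤ 2 ^ (j + 1) / l (N + j + 1) :=
            div_le_self (div_nonneg (by positivity) (hl0 _).le) (one_le_pow₀ (hl1 _))
          _ ≤ 2 ^ (N + j + 1) / l (N + j + 1) := by
            have := hl0 (N + j + 1)
            gcongr
            · norm_num
            · omega
      calc ‖v n s‖ = |a n| * |s| ^ n * ‖χ (l n * s)‖ := by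
            simp only [v, norm_mul, norm_pow, Real.norm_eq_abs]
        _ ≤ |a n| * |s| ^ n * 1 := by gcongr
        _ = |a n| * (|s| ^ N * |s| ^ (n - N)) := by
            rw [mul_one, ← pow_add, Nat.add_sub_cancel' hn.le]
        _ ≤ |a n| * (|s| ^ N * (2 ^ n / l n)) := by gcongr
        _ = |s| ^ N * (|a n| * 2 ^ n / l n) := by ring
        _ ≤ _ := by gcongr; exact hl2 n
  have hsum : ∀ s, Summable fun n => v n s := by
    intro s
    refine Summable.of_norm_bounded_eventually_nat hgeom ?_
    filter_upwards [eventually_gt_atTop 0] with n hn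
    simpa using hvN 0 n hn s
  refine ⟨fun s => ∑' n, v n s, ?_, fun N => ?_⟩
  · refine contDiff_tsum_of_eventually (v := fun _ n => (1 / 2) ^ n) hv (fun _ _ => hgeom) ?_
    intro k _
    rw [Nat.cofinite_eq_atTop]
    filter_upwards [eventually_gt_atTop k] with n hn
    exact hvk k n hn
  · have hsmall : ∀ᶠ s : ℝ in 𝓝 0, ∀ n ∈ Finset.range (N + 1), v n s = a n * s ^ n := by
      rw [Filter.eventually_all_finset]
      intro n _
      have : Tendsto (fun s : ℝ => l n * s) (𝓝 0) (𝓝 0) := by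
        have hc : Continuous fun s : ℝ => l n * s := by fun_prop
        simpa using hc.tendsto 0
      filter_upwards [this (Metric.closedBall_mem_nhds 0 one_pos)] with s hs
      have : χ (l n * s) = 1 := χ.one_of_mem_closedBall hs
      simp only [v, this, mul_one]
    refine IsBigO.of_bound (∑' n : ℕ, ((1 : ℝ) / 2) ^ (n + (N + 1))) ?_
    filter_upwards [hsmall] with s hs
    rw [← (hsum s).sum_add_tsum_nat_add (N + 1), Finset.sum_congr rfl hs, add_sub_cancel_left,
      norm_pow, Real.norm_eq_abs, mul_comm (∑' n : ℕ, ((1 : ℝ) / 2) ^ (n + (N + 1)))]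
    exact tsum_of_norm_bounded (f := fun n => v (n + (N + 1)) s)
      (((summable_nat_add_iff (N + 1)).2 hgeom).hasSum.mul_left (|s| ^ N))
      fun n => hvN N (n + (N + 1)) (by omega) s

theorem even_step (f : ℝ → ℝ) (hf : ContDiff ℝ ∞ f) (he : ∀ t, f (-t) = f t) :
    ∃ g : ℝ → ℝ, (ContDiff ℝ ∞ g ∧ ∀ t, g (-t) = g t) ∧ ∀ t, f t = f 0 + t ^ 2 * g t := by
  have hd : deriv f 0 = 0 := by
    have h1 := deriv_comp_neg f (0 : ℝ)
    simp only [he, neg_zero] at h1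
    linarith
  obtain ⟨g, hg, hfg⟩ := hadamard_pow 2 (fun t => f t - f 0) (hf.sub contDiff_const)
    (fun k hk => by
      interval_cases k
      · simp
      · simpa [iteratedDeriv_one] using hd)
  refine ⟨g, ⟨hg, fun t => ?_⟩, fun t => ?_⟩
  · refine congrFun (eq_of_punctured (fun t => g (-t)) g (hg.continuous.comp continuous_neg)
      hg.continuous fun t ht => ?_) t
    have h1 := hfg t
    have h2 := hfg (-t)
    simp only [he, neg_sq, smul_eq_mul] at h1 h2
    exact mul_left_cancel₀ (pow_ne_zero 2 ht) (h2.symm.trans h1)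
  · have := hfg t
    simp only [smul_eq_mul] at this
    linarith

theorem whitney_even_s13 (f : ℝ → ℝ) (hf : ContDiff ℝ ∞ f) (he : ∀ t, f (-t) = f t) :
    ∃ g : ℝ → ℝ, ContDiff ℝ ∞ g ∧ ∀ t, f t = g (t ^ 2) := by
  have step : ∀ f : {f : ℝ → ℝ // ContDiff ℝ ∞ f ∧ ∀ t, f (-t) = f t},
      ∃ g : {f : ℝ → ℝ // ContDiff ℝ ∞ f ∧ ∀ t, f (-t) = f t},
        ∀ t, f.1 t = f.1 0 + t ^ 2 * g.1 t := fun f => by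
    obtain ⟨g, hg, h⟩ := even_step f.1 f.2.1 f.2.2
    exact ⟨⟨g, hg⟩, h⟩
  choose T hT using step
  let F : ℕ → {f : ℝ → ℝ // ContDiff ℝ ∞ f ∧ ∀ t, f (-t) = f t} := fun n => T^[n] ⟨f, hf, he⟩
  have hF : ∀ n t, (F n).1 t = (F n).1 0 + t ^ 2 * (F (n + 1)).1 t := fun n t => by
    simp only [F, Function.iterate_succ_apply']
    exact hT _ t
  obtain ⟨b, hb, hbO⟩ := borel_lemma fun n => (F n).1 0
  have hexp : ∀ N t, f t = ∑ n ∈ Finset.range N, (F n).1 0 * (t ^ 2) ^ n +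
      (t ^ 2) ^ N * (F N).1 t := by
    intro N
    induction N with
    | zero => intro t; simp [F]
    | succ N ih =>
      intro t
      rw [ih t, Finset.sum_range_succ, hF N t]
      ring
  have hr : ContDiff ℝ ∞ fun t => f t - b (t ^ 2) := by fun_prop
  have hflat : FlatAtZero fun t => f t - b (t ^ 2) := by
    refine flat_of_isBigO _ hr fun N => ?_
    have hsq : Tendsto (fun t : ℝ => t ^ 2) (𝓝 0) (𝓝 0) := by
      have hc : Continuous fun t : ℝ => t ^ 2 := by fun_prop
      simpa using hc.tendsto 0
    have h1 := (hbO N).comp_tendsto hsq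
    have hpow : ∀ m, N ≤ m → (fun t : ℝ => t ^ m) =O[𝓝 0] fun t => t ^ N := fun m hm => by
      obtain ⟨j, rfl⟩ := Nat.exists_eq_add_of_le hm
      have hc : Continuous fun t : ℝ => t ^ j := by fun_prop
      have h5 : (fun t : ℝ => t ^ j) =O[𝓝 0] fun _ => (1 : ℝ) := (hc.tendsto 0).isBigO_one ℝ
      simpa [pow_add] using (isBigO_refl (fun t : ℝ => t ^ N) (𝓝 0)).mul h5
    have h1' : (fun t : ℝ => (t ^ 2) ^ N) =O[𝓝 0] fun t => t ^ N := by
      simp only [← pow_mul]; exact hpow _ (by omega)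
    have h2 : (fun t : ℝ => (t ^ 2) ^ (N + 1) * (F (N + 1)).1 t) =O[𝓝 0] fun t => t ^ N := by
      have h3 : (F (N + 1)).1 =O[𝓝 0] fun _ => (1 : ℝ) :=
        ((F (N + 1)).2.1.continuous.tendsto 0).isBigO_one ℝ
      have h4 : (fun t : ℝ => (t ^ 2) ^ (N + 1)) =O[𝓝 0] fun t => t ^ N := by
        simp only [← pow_mul]; exact hpow _ (by omega)
      simpa using h4.mul h3
    refine (h2.sub (h1.trans h1')).congr_left fun t => ?_
    rw [hexp (N + 1) t]
    simp only [Function.comp]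
    ring
  refine ⟨fun s => b s + if 0 < s then f (√s) - b (√s ^ 2) else 0,
    hb.add (contDiff_infty.2 fun n => contDiff_flat_sqrt n _ hr hflat), fun t => ?_⟩
  rcases eq_or_ne t 0 with rfl | ht
  · obtain ⟨h, -, h1⟩ := hflat 1
    have := h1 0
    simp at this
    simp
    linarith
  · have h1 : 0 < t ^ 2 := by positivity
    simp only [h1, if_true, Real.sqrt_sq_eq_abs, sq_abs]
    rcases abs_choice t with h | h <;> rw [h]
    · ring
    · rw [he]; ring

/-- `F` has weight `q` under rotations. -/
def HasWt (q : ℕ) (F : ℂ → ℂ) : Prop := ∀ c : ℂ, ‖c‖ = 1 → ∀ z, F (c * z) = c ^ q * F z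

theorem fderiv_wt (q : ℕ) (F : ℂ → ℂ) (hF : ContDiff ℝ ∞ F) (h : HasWt q F) (c : ℂ)
    (hc : ‖c‖ = 1) (z w : ℂ) :
    fderiv ℝ F (c * z) (c * w) = c ^ q * fderiv ℝ F z w := by
  have hd : Differentiable ℝ F := hF.differentiable (by simp)
  have hm : HasFDerivAt (fun z : ℂ => c * z) (ContinuousLinearMap.mul ℝ ℂ c) z :=
    (ContinuousLinearMap.mul ℝ ℂ c).hasFDerivAt
  have h1 := (hd (c * z)).hasFDerivAt.comp z hm
  have h2 : HasFDerivAt (fun z => c ^ q * F z) (c ^ q • fderiv ℝ F z) z :=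
    (hd z).hasFDerivAt.const_mul _
  have e : (F ∘ fun z : ℂ => c * z) = fun z => c ^ q * F z := funext fun z => h c hc z
  rw [e] at h1
  simpa using DFunLike.congr_fun (h1.unique h2) w

theorem wt_iteratedDeriv (k : ℕ) : ∀ (q : ℕ) (F : ℂ → ℂ), k < q → ContDiff ℝ ∞ F → HasWt q F →
    iteratedDeriv k (fun t : ℝ => F t) 0 = 0 := by
  induction k with
  | zero =>
    intro q F hq hF h
    obtain ⟨c, hc, hcq⟩ : ∃ c : ℂ, ‖c‖ = 1 ∧ c ^ q ≠ 1 := by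
      refine ⟨Complex.exp ((Real.pi / q : ℝ) * Complex.I), Complex.norm_exp_ofReal_mul_I _, ?_⟩
      rw [← Complex.exp_nat_mul]
      have : (q : ℂ) * ((Real.pi / q : ℝ) * Complex.I) = Real.pi * Complex.I := by
        have : (q : ℂ) ≠ 0 := by exact_mod_cast hq.ne'
        push_cast; field_simp
      rw [this, Complex.exp_pi_mul_I]
      norm_num
    have h1 := h c hc 0
    rw [mul_zero] at h1
    have h2 : (c ^ q - 1) * F 0 = 0 := by linear_combination -h1
    simpa [sub_ne_zero.2 hcq] using h2
  | succ k ih =>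
    intro q F hq hF h
    obtain ⟨q, rfl⟩ : ∃ p, q = p + 1 := ⟨q - 1, by omega⟩
    have hd : ContDiff ℝ ∞ (fderiv ℝ F) := hF.fderiv_right (by simp)
    have hG : ∀ w, ContDiff ℝ ∞ fun z => fderiv ℝ F z w := fun w => hd.clm_apply contDiff_const
    let P : ℂ → ℂ := fun z => (fderiv ℝ F z 1 - Complex.I * fderiv ℝ F z Complex.I) / 2
    let Q : ℂ → ℂ := fun z => (fderiv ℝ F z 1 + Complex.I * fderiv ℝ F z Complex.I) / 2
    have hP : ContDiff ℝ ∞ P := ((hG 1).sub (contDiff_const.mul (hG _))).div_const 2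
    have hQ : ContDiff ℝ ∞ Q := ((hG 1).add (contDiff_const.mul (hG _))).div_const 2
    have key : ∀ c : ℂ, ‖c‖ = 1 → ∀ z,
        (c.re * fderiv ℝ F (c * z) 1 + c.im * fderiv ℝ F (c * z) Complex.I =
          c ^ (q + 1) * fderiv ℝ F z 1) ∧
        (-c.im * fderiv ℝ F (c * z) 1 + c.re * fderiv ℝ F (c * z) Complex.I =
          c ^ (q + 1) * fderiv ℝ F z Complex.I) := by
      intro c hc z
      have e1 : c * 1 = c.re • (1 : ℂ) + c.im • Complex.I := by
        simp [Complex.ext_iff]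
      have e2 : c * Complex.I = (-c.im) • (1 : ℂ) + c.re • Complex.I := by
        simp [Complex.ext_iff]
      constructor
      · rw [← fderiv_wt _ F hF h c hc z 1, e1, map_add, map_smul, map_smul]; simp
      · rw [← fderiv_wt _ F hF h c hc z Complex.I, e2, map_add, map_smul, map_smul]; simp
    have hcc : ∀ c : ℂ, ‖c‖ = 1 → c * (c.re - c.im * Complex.I) = 1 := by
      intro c hc
      have h1 : c * (starRingEnd ℂ) c = 1 := by rw [Complex.mul_conj']; simp [hc]
      have h2 : (starRingEnd ℂ) c = c.re - c.im * Complex.I := by simp [Complex.ext_iff]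
      rwa [h2] at h1
    have hPw : HasWt q P := by
      intro c hc z
      obtain ⟨k1, k2⟩ := key c hc z
      have hc0 : c ≠ 0 := by rintro rfl; simp at hc
      refine mul_left_cancel₀ hc0 ?_
      simp only [P]
      have e : c = c.re + c.im * Complex.I := (Complex.re_add_im c).symm
      rw [← mul_assoc, ← pow_succ']
      have : c * ((fderiv ℝ F (c * z) 1 - Complex.I * fderiv ℝ F (c * z) Complex.I) / 2) =
          ((c.re + c.im * Complex.I) *
            ((fderiv ℝ F (c * z) 1 - Complex.I * fderiv ℝ F (c * z) Complex.I) / 2)) := by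
        rw [← e]
      rw [this]
      linear_combination (k1 - Complex.I * k2) / 2 -
        (c.im * fderiv ℝ F (c * z) Complex.I) / 2 * Complex.I_mul_I
    have hQw : HasWt (q + 2) Q := by
      intro c hc z
      obtain ⟨k1, k2⟩ := key c hc z
      have h1 := hcc c hc
      have h3 : (c.re - c.im * Complex.I) * Q (c * z) = c ^ (q + 1) * Q z := by
        simp only [Q]
        linear_combination (k1 + Complex.I * k2) / 2 -
          (c.im * fderiv ℝ F (c * z) Complex.I) / 2 * Complex.I_mul_I
      calc Q (c * z) = (c * (c.re - c.im * Complex.I)) * Q (c * z) := by rw [h1, one_mul]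
        _ = c ^ (q + 2) * Q z := by rw [mul_assoc, h3]; ring
    have hder : deriv (fun t : ℝ => F t) = fun t : ℝ => P t + Q t := by
      ext t
      have h1 : HasDerivAt (fun t : ℝ => (t : ℂ)) 1 t := Complex.ofRealCLM.hasDerivAt
      have h2 := ((hF.differentiable (by simp)) (t : ℂ)).hasFDerivAt.comp_hasDerivAt t h1
      rw [show (fun t : ℝ => F t) = F ∘ fun t : ℝ => (t : ℂ) from rfl, h2.deriv]
      simp only [P, Q]; ring
    have hof : ContDiff ℝ ∞ fun t : ℝ => (t : ℂ) := Complex.ofRealCLM.contDiff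
    rw [iteratedDeriv_succ', hder, iteratedDeriv_fun_add, ih q P (by omega) hP hPw,
      ih (q + 2) Q (by omega) hQ hQw, add_zero]
    · exact ((hP.comp hof).of_le (by exact_mod_cast le_top)).contDiffAt
    · exact ((hQ.comp hof).of_le (by exact_mod_cast le_top)).contDiffAt

theorem wt_form (q : ℕ) (F : ℂ → ℂ) (hF : ContDiff ℝ ∞ F) (h : HasWt q F) :
    ∃ g₁ g₂ : ℝ → ℝ, ContDiff ℝ ∞ g₁ ∧ ContDiff ℝ ∞ g₂ ∧
      ∀ t : ℝ, (F t).re = t ^ q * g₁ (t ^ 2) ∧ (F t).im = t ^ q * g₂ (t ^ 2) := by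
  have hof : ContDiff ℝ ∞ fun t : ℝ => (t : ℂ) := Complex.ofRealCLM.contDiff
  obtain ⟨m, hm, hFm⟩ := hadamard_pow q (fun t : ℝ => F t) (hF.comp hof)
    (fun k hk => wt_iteratedDeriv k q F hk hF h)
  have hev : ∀ t, t ≠ 0 → m (-t) = m t := by
    intro t ht
    have h1 := h (-1) (by simp) t
    have h2 := hFm t
    have h3 := hFm (-t)
    simp only [Complex.real_smul] at h2 h3
    push_cast at h2 h3
    rw [neg_one_mul, h2, h3, ← mul_assoc, ← mul_pow, neg_one_mul] at h1
    exact mul_left_cancel₀ (pow_ne_zero q (by simpa using ht)) h1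
  have hre : ContDiff ℝ ∞ fun t => (m t).re := Complex.reCLM.contDiff.comp hm
  have him : ContDiff ℝ ∞ fun t => (m t).im := Complex.imCLM.contDiff.comp hm
  have hev0 : ∀ t, m (-t) = m t := fun t => by
    rcases eq_or_ne t 0 with rfl | ht
    · simp
    · exact hev t ht
  obtain ⟨g₁, hg₁, h₁⟩ := whitney_even_s13 _ hre (fun t => by rw [hev0])
  obtain ⟨g₂, hg₂, h₂⟩ := whitney_even_s13 _ him (fun t => by rw [hev0])
  refine ⟨g₁, g₂, hg₁, hg₂, fun t => ?_⟩
  rw [← h₁, ← h₂, hFm t]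
  exact ⟨by rw [Complex.smul_re, smul_eq_mul], by rw [Complex.smul_im, smul_eq_mul]⟩

theorem inv_form (A : ℂ → ℝ) (hA : ContDiff ℝ ∞ A) (h0 : A 0 = 0)
    (h : ∀ c : ℂ, ‖c‖ = 1 → ∀ z, A (c * z) = A z) :
    ∃ g : ℝ → ℝ, ContDiff ℝ ∞ g ∧ ∀ t : ℝ, A t = t ^ 2 * g (t ^ 2) := by
  have hof : ContDiff ℝ ∞ fun t : ℝ => (t : ℂ) := Complex.ofRealCLM.contDiff
  obtain ⟨g, hg, hAg⟩ := whitney_even_s13 (fun t : ℝ => A t) (hA.comp hof)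
    (fun t => by simpa using h (-1) (by simp) t)
  obtain ⟨m, hm, hgm⟩ := hadamard_one g hg (by simpa [h0] using (hAg 0).symm)
  exact ⟨m, hm, fun t => by rw [hAg, hgm, smul_eq_mul]⟩

theorem rot_parts (α : ℝ) (M : Matrix (Fin 2) (Fin 2) ℝ) :
    let N := rotMat α * M * (rotMat α)ᵀ
    N 0 0 + N 1 1 = M 0 0 + M 1 1 ∧ N 0 1 - N 1 0 = M 0 1 - M 1 0 ∧
    (⟨N 0 0 - N 1 1, N 0 1 + N 1 0⟩ : ℂ) =
      Complex.exp ((2 * α : ℝ) * Complex.I) * ⟨M 0 0 - M 1 1, M 0 1 + M 1 0⟩ := by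
  have h := Real.sin_sq_add_cos_sq α
  simp only [rotMat, Matrix.mul_apply, Fin.sum_univ_two, Matrix.transpose_apply, Matrix.of_apply,
    Matrix.cons_val', Matrix.cons_val_zero, Matrix.cons_val_one, Matrix.cons_val_fin_one]
  refine ⟨?_, ?_, ?_⟩
  · linear_combination (M 0 0 + M 1 1) * h
  · linear_combination (M 0 1 - M 1 0) * h
  · apply Complex.ext
    · rw [Complex.mul_re, Complex.exp_ofReal_mul_I_re, Complex.exp_ofReal_mul_I_im,
        Real.cos_two_mul', Real.sin_two_mul]
      ring
    · rw [Complex.mul_im, Complex.exp_ofReal_mul_I_re, Complex.exp_ofReal_mul_I_im,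
        Real.cos_two_mul', Real.sin_two_mul]
      ring

theorem equiv_parts (a d : ℕ) (ha : 0 < a) (hdvd : a ∣ 2 * d)
    (H : ℂ → Matrix (Fin 2) (Fin 2) ℝ)
    (hequiv : ∀ (θ : ℝ) (z : ℂ), z ≠ 0 →
      H (Complex.exp ((a * θ : ℝ) * Complex.I) * z) =
        rotMat (d * θ) * H z * (rotMat (d * θ))ᵀ) (c z : ℂ) (hc : ‖c‖ = 1) (hz : z ≠ 0) :
    H (c * z) 0 0 + H (c * z) 1 1 = H z 0 0 + H z 1 1 ∧
    H (c * z) 0 1 - H (c * z) 1 0 = H z 0 1 - H z 1 0 ∧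
    (⟨H (c * z) 0 0 - H (c * z) 1 1, H (c * z) 0 1 + H (c * z) 1 0⟩ : ℂ) =
      c ^ (2 * d / a) * ⟨H z 0 0 - H z 1 1, H z 0 1 + H z 1 0⟩ := by
  have ha' : (a : ℝ) ≠ 0 := by exact_mod_cast ha.ne'
  have e1 : Complex.exp ((a * (c.arg / a) : ℝ) * Complex.I) = c := by
    rw [mul_div_cancel₀ _ ha']
    simpa [hc] using Complex.norm_mul_exp_arg_mul_I c
  have h1 := hequiv (c.arg / a) z hz
  rw [e1] at h1
  have h2 := rot_parts (d * (c.arg / a)) (H z)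
  simp only [← h1] at h2
  refine ⟨h2.1, h2.2.1, h2.2.2.trans ?_⟩
  congr 1
  obtain ⟨q, hq⟩ := hdvd
  rw [hq, Nat.mul_div_cancel_left _ ha]
  nth_rw 2 [← e1]
  rw [← Complex.exp_nat_mul]
  congr 1
  have hq' : (2 * d : ℂ) = a * q := by exact_mod_cast hq
  have ha'' : (a : ℂ) ≠ 0 := by exact_mod_cast ha.ne'
  push_cast
  field_simp
  linear_combination hq' * c.arg

theorem smooth_vanishing_extension_iff_equal_speed_products
    (a d : ℕ) (ha : 0 < a) (hd : 0 < d) (hdvd : a ∣ 2 * d)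
    (H : ℂ → Matrix (Fin 2) (Fin 2) ℝ)
    (hsmooth : ∀ i j : Fin 2, ContDiffOn ℝ (⊤ : ℕ∞) (fun z => H z i j) {0}ᶜ)
    (hequiv : ∀ (θ : ℝ) (z : ℂ), z ≠ 0 →
      H (Complex.exp ((a * θ : ℝ) * Complex.I) * z) =
        rotMat (d * θ) * H z * (rotMat (d * θ))ᵀ) :
    (∃ He : ℂ → Matrix (Fin 2) (Fin 2) ℝ,
        (∀ i j : Fin 2, ContDiff ℝ (⊤ : ℕ∞) fun z => He z i j) ∧
        He 0 = 0 ∧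
        ∀ z : ℂ, z ≠ 0 → He z = H z) ↔
      ∃ φ₁ φ₂ φ₃ φ₄ : ℝ → ℝ,
        ContDiff ℝ (⊤ : ℕ∞) φ₁ ∧ ContDiff ℝ (⊤ : ℕ∞) φ₂ ∧
        ContDiff ℝ (⊤ : ℕ∞) φ₃ ∧ ContDiff ℝ (⊤ : ℕ∞) φ₄ ∧
        ∀ t : ℝ, 0 < t →
          H (t : ℂ) 0 0 = t ^ 2 * φ₁ (t ^ 2) + t ^ (2 * d / a) * φ₃ (t ^ 2) ∧
          H (t : ℂ) 1 1 = t ^ 2 * φ₁ (t ^ 2) - t ^ (2 * d / a) * φ₃ (t ^ 2) ∧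
          H (t : ℂ) 0 1 = t ^ 2 * φ₂ (t ^ 2) + t ^ (2 * d / a) * φ₄ (t ^ 2) ∧
          H (t : ℂ) 1 0 = -(t ^ 2 * φ₂ (t ^ 2)) + t ^ (2 * d / a) * φ₄ (t ^ 2) := by
  have hparts := equiv_parts a d ha hdvd H hequiv
  have hq0 : 2 * d / a ≠ 0 := by
    obtain ⟨q, hq⟩ := hdvd
    rw [hq, Nat.mul_div_cancel_left _ ha]
    rintro rfl
    omega
  generalize 2 * d / a = q at hparts hq0 ⊢
  constructor
  · rintro ⟨He, hHe, hHe0, hHH⟩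
    have hcz : ∀ c : ℂ, ‖c‖ = 1 → c ≠ 0 := by rintro c hc rfl; simp at hc
    have hp : ∀ c z : ℂ, ‖c‖ = 1 →
        He (c * z) 0 0 + He (c * z) 1 1 = He z 0 0 + He z 1 1 ∧
        He (c * z) 0 1 - He (c * z) 1 0 = He z 0 1 - He z 1 0 ∧
        (⟨He (c * z) 0 0 - He (c * z) 1 1, He (c * z) 0 1 + He (c * z) 1 0⟩ : ℂ) =
          c ^ q * ⟨He z 0 0 - He z 1 1, He z 0 1 + He z 1 0⟩ := by
      intro c z hc
      rcases eq_or_ne z 0 with rfl | hz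
      · have : (⟨0, 0⟩ : ℂ) = 0 := rfl
        simp [hHe0, this]
      · rw [hHH z hz, hHH (c * z) (mul_ne_zero (hcz c hc) hz)]
        exact hparts c z hc hz
    obtain ⟨g₁, hg₁, h₁⟩ := inv_form (fun z => He z 0 0 + He z 1 1) ((hHe 0 0).add (hHe 1 1))
      (by simp [hHe0]) (fun c hc z => (hp c z hc).1)
    obtain ⟨g₂, hg₂, h₂⟩ := inv_form (fun z => He z 0 1 - He z 1 0) ((hHe 0 1).sub (hHe 1 0))
      (by simp [hHe0]) (fun c hc z => (hp c z hc).2.1)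
    have hF : ContDiff ℝ ∞ fun z => (⟨He z 0 0 - He z 1 1, He z 0 1 + He z 1 0⟩ : ℂ) := by
      have e : (fun z => (⟨He z 0 0 - He z 1 1, He z 0 1 + He z 1 0⟩ : ℂ)) =
          fun z => Complex.ofRealCLM (He z 0 0 - He z 1 1) +
            Complex.ofRealCLM (He z 0 1 + He z 1 0) * Complex.I := by
        ext z
        exact Complex.mk_eq_add_mul_I _ _
      rw [e]
      exact (Complex.ofRealCLM.contDiff.comp ((hHe 0 0).sub (hHe 1 1))).add
        ((Complex.ofRealCLM.contDiff.comp ((hHe 0 1).add (hHe 1 0))).mul contDiff_const)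
    obtain ⟨g₃, g₄, hg₃, hg₄, h₃⟩ := wt_form q _ hF (fun c hc z => (hp c z hc).2.2)
    refine ⟨fun s => g₁ s / 2, fun s => g₂ s / 2, fun s => g₃ s / 2, fun s => g₄ s / 2,
      hg₁.div_const 2, hg₂.div_const 2, hg₃.div_const 2, hg₄.div_const 2, fun t ht => ?_⟩
    rw [← hHH t (by exact_mod_cast ht.ne')]
    have k1 := h₁ t
    have k2 := h₂ t
    obtain ⟨k3, k4⟩ := h₃ t
    simp only at k1 k2 k3 k4
    refine ⟨?_, ?_, ?_, ?_⟩ <;> linarith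
  · rintro ⟨φ₁, φ₂, φ₃, φ₄, h1, h2, h3, h4, hH⟩
    let G : ℂ → ℂ := fun z => z ^ q * (⟨φ₃ (Complex.normSq z), φ₄ (Complex.normSq z)⟩ : ℂ)
    have hns : ContDiff ℝ ∞ fun z : ℂ => Complex.normSq z := by
      simp only [Complex.normSq_apply]
      have hr : ContDiff ℝ ∞ fun z : ℂ => z.re := Complex.reCLM.contDiff
      have hi : ContDiff ℝ ∞ fun z : ℂ => z.im := Complex.imCLM.contDiff
      exact (hr.mul hr).add (hi.mul hi)
    have hG : ContDiff ℝ ∞ G := by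
      have e : G = fun z => z ^ q * (Complex.ofRealCLM (φ₃ (Complex.normSq z)) +
            Complex.ofRealCLM (φ₄ (Complex.normSq z)) * Complex.I) := by
        ext z
        simp only [G]
        congr 1
        exact Complex.mk_eq_add_mul_I _ _
      rw [e]
      exact (contDiff_id.pow q).mul ((Complex.ofRealCLM.contDiff.comp (h3.comp hns)).add
        ((Complex.ofRealCLM.contDiff.comp (h4.comp hns)).mul contDiff_const))
    have hGr : ContDiff ℝ ∞ fun z => (G z).re := Complex.reCLM.contDiff.comp hG
    have hGi : ContDiff ℝ ∞ fun z => (G z).im := Complex.imCLM.contDiff.comp hG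
    have hA : ContDiff ℝ ∞ fun z : ℂ => Complex.normSq z * φ₁ (Complex.normSq z) :=
      hns.mul (h1.comp hns)
    have hB : ContDiff ℝ ∞ fun z : ℂ => Complex.normSq z * φ₂ (Complex.normSq z) :=
      hns.mul (h2.comp hns)
    refine ⟨fun z => !![Complex.normSq z * φ₁ (Complex.normSq z) + (G z).re,
        Complex.normSq z * φ₂ (Complex.normSq z) + (G z).im;
        -(Complex.normSq z * φ₂ (Complex.normSq z)) + (G z).im,
        Complex.normSq z * φ₁ (Complex.normSq z) - (G z).re], ?_, ?_, ?_⟩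
    · intro i j
      fin_cases i <;> fin_cases j
      · exact hA.add hGr
      · exact hB.add hGi
      · exact hB.neg.add hGi
      · exact hA.sub hGr
    · ext i j
      fin_cases i <;> fin_cases j <;> simp [G, hq0]
    · intro z hz
      have hr : 0 < ‖z‖ := norm_pos_iff.2 hz
      have hr' : (‖z‖ : ℂ) ≠ 0 := by exact_mod_cast hr.ne'
      have hcz : z / ‖z‖ * ‖z‖ = z := div_mul_cancel₀ z hr'
      obtain ⟨p1, p2, p3⟩ := hparts (z / ‖z‖) ‖z‖ (by simp [hr.ne']) hr'
      obtain ⟨k1, k2, k3, k4⟩ := hH ‖z‖ hr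
      rw [hcz] at p1 p2 p3
      have hn : ‖z‖ ^ 2 = Complex.normSq z := Complex.sq_norm z
      rw [hn] at k1 k2 k3 k4
      have e3 : (⟨H ‖z‖ 0 0 - H ‖z‖ 1 1, H ‖z‖ 0 1 + H ‖z‖ 1 0⟩ : ℂ) =
          2 * ((‖z‖ : ℂ) ^ q * ⟨φ₃ (Complex.normSq z), φ₄ (Complex.normSq z)⟩) := by
        rw [← Complex.ofReal_pow]
        generalize ‖z‖ ^ q = r at k1 k2 k3 k4 ⊢
        apply Complex.ext
        · simp [k1, k2]; ring
        · simp [k3, k4]; ring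
      have e4 : (⟨H z 0 0 - H z 1 1, H z 0 1 + H z 1 0⟩ : ℂ) = 2 * G z := by
        rw [p3, e3]
        simp only [G]
        rw [div_pow]
        field_simp
      have r1 := congrArg Complex.re e4
      have r2 := congrArg Complex.im e4
      simp at r1 r2
      ext i j
      fin_cases i <;> fin_cases j <;> simp <;> linarith
end
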